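/- arXiv:2511.16238 — 6 statements merged into one kernel-verified Lean document; each statement's English description precedes it below -/
import Mathlib

section
/- Let H be a real inner product space, let B : H → H be a continuous linear map that is self-adjoint (⟨B v, w⟩ = ⟨v, B w⟩ for all v, w) and nonnegative (⟨B v, v⟩ ≥ 0 for all v). Let T > 0, let r : [0,T] → ℝ and f : [0,T] → H be continuous, and let u : [0,T] → H be differentiable with u'(t) + B(u(t)) = r(t) • f(t) for all t ∈ [0,T]. Then for every ε > 0 and every t ∈ [0,T], ‖u(t)‖² + 2∫₀ᵗ ⟨B(u(τ)), u(τ)⟩ dτ ≤ (‖u(0)‖² + (1/ε)∫₀ᵗ (r(τ))² ‖f(τ)‖² dτ) · exp(ε t). -/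
open scoped RealInnerProductSpace

/-- The primitive of a function continuous on `[0,T]`: continuity and interior derivative. -/
lemma primitive_aux (T : ℝ) (hT : 0 < T) (q : ℝ → ℝ) (hq : ContinuousOn q (Set.Icc 0 T)) :
    ContinuousOn (fun t => ∫ τ in (0 : ℝ)..t, q τ) (Set.Icc 0 T) ∧
    ∀ t ∈ Set.Ioo 0 T, HasDerivAt (fun t => ∫ τ in (0 : ℝ)..t, q τ) (q t) t := by
  constructor
  · have h := intervalIntegral.continuousOn_primitive_interval (f := q) (a := 0) (b := T)
      (μ := MeasureTheory.volume)
    rw [Set.uIcc_of_le hT.le] at h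
    exact h hq.integrableOn_Icc
  · intro t ht
    have hq' : ContinuousOn q (Set.Ioo 0 T) := hq.mono Set.Ioo_subset_Icc_self
    apply intervalIntegral.integral_hasDerivAt_right
    · apply ContinuousOn.intervalIntegrable
      rw [Set.uIcc_of_le ht.1.le]
      exact hq.mono (Set.Icc_subset_Icc_right ht.2.le)
    · exact hq'.stronglyMeasurableAtFilter isOpen_Ioo t ht
    · exact hq'.continuousAt (isOpen_Ioo.mem_nhds ht)

/-- A priori energy estimate for the abstract evolution equation `u' + B u = r • f`
in a real inner product space, where `B` is self-adjoint and nonnegative. -/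
theorem apriori_estimate
    {H : Type*} [NormedAddCommGroup H] [InnerProductSpace ℝ H]
    (B : H →L[ℝ] H)
    (hBsa : ∀ v w : H, ⟪B v, w⟫ = ⟪v, B w⟫)
    (hBpos : ∀ v : H, 0 ≤ ⟪B v, v⟫)
    (T : ℝ) (hT : 0 < T)
    (r : ℝ → ℝ) (f : ℝ → H)
    (hr : ContinuousOn r (Set.Icc 0 T)) (hf : ContinuousOn f (Set.Icc 0 T))
    (u u' : ℝ → H)
    (hu : ∀ t ∈ Set.Icc (0 : ℝ) T, HasDerivWithinAt u (u' t) (Set.Icc 0 T) t)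
    (heq : ∀ t ∈ Set.Icc (0 : ℝ) T, u' t + B (u t) = r t • f t) :
    ∀ ε > (0 : ℝ), ∀ t ∈ Set.Icc (0 : ℝ) T,
      ‖u t‖ ^ 2 + 2 * ∫ τ in (0 : ℝ)..t, ⟪B (u τ), u τ⟫
        ≤ (‖u 0‖ ^ 2 + (1 / ε) * ∫ τ in (0 : ℝ)..t, (r τ) ^ 2 * ‖f τ‖ ^ 2)
            * Real.exp (ε * t) := by
  intro ε hε t ht
  have huc : ContinuousOn u (Set.Icc 0 T) := fun s hs => (hu s hs).continuousWithinAt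
  have hBc : ContinuousOn (fun s => B (u s)) (Set.Icc 0 T) := B.continuous.comp_continuousOn huc
  obtain ⟨hPc, hPd⟩ := primitive_aux T hT (fun s => ⟪B (u s), u s⟫) (hBc.inner huc)
  obtain ⟨hGc, hGd⟩ := primitive_aux T hT (fun s => (r s) ^ 2 * ‖f s‖ ^ 2)
    ((hr.pow 2).mul (hf.norm.pow 2))
  set P : ℝ → ℝ := fun t => ∫ τ in (0 : ℝ)..t, ⟪B (u τ), u τ⟫ with hP
  set G : ℝ → ℝ := fun t => ∫ τ in (0 : ℝ)..t, (r τ) ^ 2 * ‖f τ‖ ^ 2 with hG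
  have hanti : AntitoneOn (fun s => Real.exp (-(ε * s)) * (‖u s‖ ^ 2 + 2 * P s) - (1 / ε) * G s)
      (Set.Icc 0 T) := by
    refine antitoneOn_of_hasDerivWithinAt_nonpos (convex_Icc 0 T)
      (f' := fun s => (Real.exp (-(ε * s)) * (-(ε * 1))) * (‖u s‖ ^ 2 + 2 * P s)
        + Real.exp (-(ε * s)) * (2 * ⟪u s, u' s⟫ + 2 * ⟪B (u s), u s⟫)
        - (1 / ε) * ((r s) ^ 2 * ‖f s‖ ^ 2)) ?_ ?_ ?_
    · have he : ContinuousOn (fun s : ℝ => Real.exp (-(ε * s))) (Set.Icc 0 T) := by fun_prop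
      exact (he.mul ((huc.norm.pow 2).add (continuousOn_const.mul hPc))).sub
        (continuousOn_const.mul hGc)
    · intro s hs
      rw [interior_Icc] at hs ⊢
      have h1 : HasDerivAt u (u' s) s :=
        (hu s (Set.Ioo_subset_Icc_self hs)).hasDerivAt (Icc_mem_nhds hs.1 hs.2)
      have he : HasDerivAt (fun s : ℝ => Real.exp (-(ε * s)))
          (Real.exp (-(ε * s)) * (-(ε * 1))) s :=
        (((hasDerivAt_id s).const_mul ε).neg).exp
      exact ((he.mul (h1.norm_sq.add ((hPd s hs).const_mul 2))).sub
        ((hGd s hs).const_mul (1 / ε))).hasDerivWithinAt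
    · intro s hs
      rw [interior_Icc] at hs
      have hs' := Set.Ioo_subset_Icc_self hs
      have hPs : 0 ≤ P s :=
        intervalIntegral.integral_nonneg hs.1.le (fun x _ => hBpos (u x))
      have hu' : u' s = r s • f s - B (u s) := eq_sub_of_add_eq (heq s hs')
      have h1 : ⟪u s, u' s⟫ + ⟪B (u s), u s⟫ = ⟪u s, r s • f s⟫ := by
        rw [hu', inner_sub_right, hBsa]; ring
      have h2 : ⟪u s, r s • f s⟫ ≤ ‖u s‖ * ‖r s • f s‖ := real_inner_le_norm _ _
      have h3 : (r s) ^ 2 * ‖f s‖ ^ 2 = ‖r s • f s‖ ^ 2 := by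
        rw [norm_smul, mul_pow, Real.norm_eq_abs, sq_abs]
      have hE : Real.exp (-(ε * s)) ≤ 1 :=
        Real.exp_le_one_iff.2 (neg_nonpos.2 (mul_nonneg hε.le hs.1.le))
      have hE0 := Real.exp_pos (-(ε * s))
      have h4 : 2 * (‖u s‖ * ‖r s • f s‖) ≤ ε * ‖u s‖ ^ 2 + (1 / ε) * ‖r s • f s‖ ^ 2 := by
        have : ε * ‖u s‖ ^ 2 + (1 / ε) * ‖r s • f s‖ ^ 2 - 2 * (‖u s‖ * ‖r s • f s‖)
            = (1 / ε) * (ε * ‖u s‖ - ‖r s • f s‖) ^ 2 := by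
          field_simp
          ring
        have h5 : 0 ≤ (1 / ε) * (ε * ‖u s‖ - ‖r s • f s‖) ^ 2 := by positivity
        linarith
      have hg : 0 ≤ (1 / ε) * ‖r s • f s‖ ^ 2 := by positivity
      have h6 : 0 ≤ ε * P s := mul_nonneg hε.le hPs
      simp only [h3]
      have h7 : 2 * ⟪u s, u' s⟫ + 2 * ⟪B (u s), u s⟫ - ε * (‖u s‖ ^ 2 + 2 * P s)
          ≤ (1 / ε) * ‖r s • f s‖ ^ 2 := by linarith
      have h8 := mul_le_mul_of_nonneg_left h7 hE0.le
      have h9 := mul_le_mul_of_nonneg_right hE hg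
      linarith
  have h := hanti (Set.left_mem_Icc.2 hT.le) ht ht.1
  have hP0 : P 0 = 0 := by simp [hP]
  have hG0 : G 0 = 0 := by simp [hG]
  simp only [hP0, hG0, mul_zero, neg_zero, Real.exp_zero, one_mul, add_zero, sub_zero] at h
  change ‖u t‖ ^ 2 + 2 * P t ≤ (‖u 0‖ ^ 2 + (1 / ε) * G t) * Real.exp (ε * t)
  have h' : Real.exp (-(ε * t)) * (‖u t‖ ^ 2 + 2 * P t) ≤ ‖u 0‖ ^ 2 + (1 / ε) * G t := by
    linarith
  calc ‖u t‖ ^ 2 + 2 * P t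
      = Real.exp (-(ε * t)) * (‖u t‖ ^ 2 + 2 * P t) * Real.exp (ε * t) := by
        rw [mul_right_comm, ← Real.exp_add]; simp
    _ ≤ _ := mul_le_mul_of_nonneg_right h' (Real.exp_pos _).le
end

section
/- Let n ≥ 1, let A be a real symmetric positive semidefinite n × n matrix, let τ > 0 and M ≥ 1. Let U⁰, U¹, …, U^M ∈ ℝⁿ, r⁰, …, r^{M−1} ∈ ℝ, and F⁰, …, F^{M−1} ∈ ℝⁿ satisfy, for each k = 0, …, M−1, the Crank–Nicolson step (Uᵏ⁺¹ − Uᵏ)/τ + (1/2) A (Uᵏ⁺¹ + Uᵏ) = rᵏ • Fᵏ. Then for every m with 1 ≤ m ≤ M, ‖Uᵐ‖ ≤ ‖U⁰‖ + Σ_{k=0}^{m−1} τ |rᵏ| ‖Fᵏ‖, where ‖·‖ is the Euclidean norm on ℝⁿ. -/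
open scoped RealInnerProductSpace

/-- Unconditional `L²`-stability with forcing of the Crank–Nicolson scheme:
if `(Uᵏ⁺¹ − Uᵏ)/τ + (1/2) A (Uᵏ⁺¹ + Uᵏ) = rᵏ • Fᵏ` for `k = 0, …, M−1`, then
`‖Uᵐ‖ ≤ ‖U⁰‖ + Σ_{k<m} τ |rᵏ| ‖Fᵏ‖` for `1 ≤ m ≤ M`. -/
theorem CN_L2_stability_with_forcing
    (n : ℕ) (hn : 1 ≤ n) (A : Matrix (Fin n) (Fin n) ℝ)
    (hA : A.IsSymm) (hApsd : A.PosSemidef)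
    (τ : ℝ) (hτ : 0 < τ) (M : ℕ) (hM : 1 ≤ M)
    (U : ℕ → EuclideanSpace ℝ (Fin n)) (r : ℕ → ℝ)
    (F : ℕ → EuclideanSpace ℝ (Fin n))
    (hstep : ∀ k < M,
      τ⁻¹ • (U (k + 1) - U k)
          + (1 / 2 : ℝ) • Matrix.toEuclideanLin A (U (k + 1) + U k)
        = r k • F k) :
    ∀ m, 1 ≤ m → m ≤ M →
      ‖U m‖ ≤ ‖U 0‖ + ∑ k ∈ Finset.range m, τ * |r k| * ‖F k‖ := by
  have hpos : ∀ x : EuclideanSpace ℝ (Fin n), 0 ≤ ⟪Matrix.toEuclideanLin A x, x⟫ := by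
    intro x
    exact (Matrix.isPositive_toEuclideanLin_iff.mpr hApsd).re_inner_nonneg_left x
  have key : ∀ k < M, ‖U (k + 1)‖ ≤ ‖U k‖ + τ * |r k| * ‖F k‖ := by
    intro k hk
    have h := congrArg (fun v => ⟪v, U (k + 1) + U k⟫) (hstep k hk)
    simp only [inner_add_left, real_inner_smul_left] at h
    have h1 : ⟪U (k + 1) - U k, U (k + 1) + U k⟫ = ‖U (k + 1)‖ ^ 2 - ‖U k‖ ^ 2 := by
      rw [inner_add_right, inner_sub_left, inner_sub_left, real_inner_self_eq_norm_sq,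
        real_inner_self_eq_norm_sq, real_inner_comm (U k) (U (k + 1))]
      ring
    rw [h1] at h
    have h2 := hpos (U (k + 1) + U k)
    have h3 : r k * ⟪F k, U (k + 1) + U k⟫ ≤ |r k| * ‖F k‖ * (‖U (k + 1)‖ + ‖U k‖) := by
      calc r k * ⟪F k, U (k + 1) + U k⟫ ≤ |r k| * |⟪F k, U (k + 1) + U k⟫| := by
            rw [← abs_mul]; exact le_abs_self _
        _ ≤ |r k| * (‖F k‖ * (‖U (k + 1)‖ + ‖U k‖)) := by
            gcongr
            refine (abs_real_inner_le_norm _ _).trans ?_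
            gcongr
            exact norm_add_le _ _
        _ = _ := by ring
    have h4 : τ⁻¹ * (‖U (k + 1)‖ ^ 2 - ‖U k‖ ^ 2)
        ≤ |r k| * ‖F k‖ * (‖U (k + 1)‖ + ‖U k‖) := by linarith
    rw [inv_mul_le_iff₀ hτ] at h4
    have hc : 0 ≤ τ * |r k| * ‖F k‖ := by positivity
    have ha := norm_nonneg (U (k + 1))
    have hb := norm_nonneg (U k)
    by_contra! hlt
    have hs : 0 < ‖U (k + 1)‖ + ‖U k‖ := by linarith
    have := mul_pos hs (sub_pos.mpr hlt)
    nlinarith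
  intro m _ hm
  clear hM
  have : ∀ m, m ≤ M → ‖U m‖ ≤ ‖U 0‖ + ∑ k ∈ Finset.range m, τ * |r k| * ‖F k‖ := by
    intro m
    induction m with
    | zero => intro _; simp
    | succ j ih =>
      intro hj
      rw [Finset.sum_range_succ]
      have h1 := ih (by omega)
      have h2 := key j (by omega)
      linarith
  exact this m hm
end

section
/- Let n ≥ 1, let A be a real symmetric positive definite n × n matrix, let τ > 0 and M ≥ 1. Let U⁰, …, U^M ∈ ℝⁿ, r⁰, …, r^{M−1} ∈ ℝ, and F⁰, …, F^{M−1} ∈ ℝⁿ satisfy, for each k = 0, …, M−1, (Uᵏ⁺¹ − Uᵏ)/τ + (1/2) A (Uᵏ⁺¹ + Uᵏ) = rᵏ • Fᵏ. Set Uᵏ⁺¹ᐟ² := (Uᵏ⁺¹ + Uᵏ)/2. Then for every m with 1 ≤ m ≤ M, ‖Uᵐ‖² + Σ_{k=0}^{m−1} τ ⟨A Uᵏ⁺¹ᐟ², Uᵏ⁺¹ᐟ²⟩ ≤ ‖U⁰‖² + Σ_{k=0}^{m−1} τ (rᵏ)² ⟨A⁻¹ Fᵏ, Fᵏ⟩,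 where ‖·‖ and ⟨·,·⟩ are the Euclidean norm and inner product on ℝⁿ and A⁻¹ is the matrix inverse of A. -/
open scoped RealInnerProductSpace

theorem CN_one_step {E : Type*} [NormedAddCommGroup E] [InnerProductSpace ℝ E]
    (L : E →ₗ[ℝ] E) (hs : ∀ x y, ⟪L x, y⟫ = ⟪x, L y⟫) (hp : ∀ x, 0 ≤ ⟪L x, x⟫)
    (τ : ℝ) (hτ : 0 < τ) (V W F G : E) (r : ℝ) (hG : L G = F)
    (h : τ⁻¹ • (V - W) + (1 / 2 : ℝ) • L (V + W) = r • F) :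
    ‖V‖ ^ 2 + τ * ⟪L ((1 / 2 : ℝ) • (V + W)), (1 / 2 : ℝ) • (V + W)⟫
      ≤ ‖W‖ ^ 2 + τ * r ^ 2 * ⟪G, F⟫ := by
  obtain ⟨w, hw⟩ : ∃ w, w = (1 / 2 : ℝ) • (V + W) := ⟨_, rfl⟩
  rw [← map_smul, ← hw] at h
  rw [← hw]
  have h1 : ⟪V - W, w⟫ = (‖V‖ ^ 2 - ‖W‖ ^ 2) / 2 := by
    rw [hw, inner_smul_right, inner_add_right, inner_sub_left, inner_sub_left,
      real_inner_self_eq_norm_sq, real_inner_self_eq_norm_sq, real_inner_comm W V]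
    ring
  have h2 := congrArg (fun z => ⟪z, w⟫) h
  simp only [inner_add_left, real_inner_smul_left] at h2
  rw [h1] at h2
  have h3 := hp (w - r • G)
  simp only [map_sub, map_smul, hG, inner_sub_left, inner_sub_right, real_inner_smul_left,
    real_inner_smul_right] at h3
  rw [hs w G, hG, real_inner_comm F w, real_inner_comm G F] at h3
  have h4 : (‖V‖ ^ 2 - ‖W‖ ^ 2) / 2 = τ * (r * ⟪F, w⟫ - ⟪L w, w⟫) := by
    rw [← h2]
    field_simp
    ring
  have h5 := mul_nonneg hτ.le h3
  simp only [real_inner_comm] at h4 h5 ⊢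
  nlinarith

/-- Crank–Nicolson energy estimate with dissipation:
`‖Uᵐ‖² + Σ_{k<m} τ ⟨A Uᵏ⁺¹ᐟ², Uᵏ⁺¹ᐟ²⟩ ≤ ‖U⁰‖² + Σ_{k<m} τ (rᵏ)² ⟨A⁻¹ Fᵏ, Fᵏ⟩`,
where `Uᵏ⁺¹ᐟ² = (Uᵏ⁺¹ + Uᵏ)/2` and `A` is symmetric positive definite. -/
theorem CN_energy_estimate_with_dissipation
    (n : ℕ) (hn : 1 ≤ n) (A : Matrix (Fin n) (Fin n) ℝ)
    (hA : A.IsSymm) (hApd : A.PosDef)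
    (τ : ℝ) (hτ : 0 < τ) (M : ℕ) (hM : 1 ≤ M)
    (U : ℕ → EuclideanSpace ℝ (Fin n)) (r : ℕ → ℝ)
    (F : ℕ → EuclideanSpace ℝ (Fin n))
    (hstep : ∀ k < M,
      τ⁻¹ • (U (k + 1) - U k)
          + (1 / 2 : ℝ) • Matrix.toEuclideanLin A (U (k + 1) + U k)
        = r k • F k) :
    ∀ m, 1 ≤ m → m ≤ M →
      ‖U m‖ ^ 2
          + ∑ k ∈ Finset.range m,
              τ * ⟪Matrix.toEuclideanLin A ((1 / 2 : ℝ) • (U (k + 1) + U k)),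
                    (1 / 2 : ℝ) • (U (k + 1) + U k)⟫
        ≤ ‖U 0‖ ^ 2
          + ∑ k ∈ Finset.range m,
              τ * (r k) ^ 2 * ⟪Matrix.toEuclideanLin A⁻¹ (F k), F k⟫ := by
  have hdet : IsUnit A.det := (Matrix.isUnit_iff_isUnit_det A).mp hApd.isUnit
  have hpos := Matrix.isPositive_toEuclideanLin_iff.mpr hApd.posSemidef
  intro m hm1
  clear hm1
  induction m with
  | zero => intro _; simp
  | succ k ih =>
    intro hk
    have ih' := ih (by omega)
    rw [Finset.sum_range_succ, Finset.sum_range_succ]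
    have := CN_one_step (Matrix.toEuclideanLin A) hpos.isSymmetric
      (fun x => by simpa using hpos.2 x) τ hτ (U (k + 1)) (U k) (F k)
      (Matrix.toEuclideanLin A⁻¹ (F k)) (r k)
      (by simp [Matrix.toLpLin_apply, Matrix.mulVec_mulVec, Matrix.mul_nonsing_inv A hdet])
      (hstep k (by omega))
    linarith
end

section
/- Let N ≥ 2, s ∈ (0,1), h > 0 and c > 0, and define the real (N−1) × (N−1) matrix A (with indices i, j ∈ {1, …, N−1}) by A_{ij} = −(c/h^{2s}) · |i − j|^{−(1+2s)} for i ≠ j, and A_{ii} = (c/h^{2s}) · [ Σ_{j=1, j≠i}^{N−1} |i − j|^{−(1+2s)} + (1/(2s)) (i^{−2s} + (N−i)^{−2s}) ]. Then A is symmetric and positive definite: Aᵀ = A, and ⟨A x, x⟩ > 0 for every nonzero x ∈ ℝ^{N−1}. -/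
open scoped Matrix

/-- A symmetric weighted graph Laplacian plus a positive diagonal is positive definite. -/
lemma laplacian_add_diag_pos {ι : Type*} [Fintype ι] [DecidableEq ι]
    (A w : ι → ι → ℝ) (d : ι → ℝ) (hw : ∀ i j, 0 ≤ w i j) (hsym : ∀ i j, w i j = w j i)
    (hd : ∀ i, 0 < d i) (hoff : ∀ i j, i ≠ j → A i j = - w i j)
    (hdiag : ∀ i, A i i = (∑ j ∈ Finset.univ.erase i, w i j) + d i)
    (x : ι → ℝ) (hx : x ≠ 0) : 0 < ∑ i, (∑ j, A i j * x j) * x i := by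
  have hrow : ∀ i, (∑ j, A i j * x j) * x i
      = (∑ j, w i j * (x i - x j) * x i) + d i * x i ^ 2 := by
    intro i
    rw [← Finset.add_sum_erase _ _ (Finset.mem_univ i),
      ← Finset.add_sum_erase _ (fun j => w i j * (x i - x j) * x i) (Finset.mem_univ i), hdiag]
    have h1 : ∑ j ∈ Finset.univ.erase i, A i j * x j
        = ∑ j ∈ Finset.univ.erase i, -(w i j * x j) := by
      refine Finset.sum_congr rfl fun j hj => ?_
      rw [hoff i j (Finset.ne_of_mem_erase hj).symm]
      ring
    have h2 : ∑ j ∈ Finset.univ.erase i, w i j * (x i - x j) * x i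
        = ((∑ j ∈ Finset.univ.erase i, w i j) * x i
          + ∑ j ∈ Finset.univ.erase i, -(w i j * x j)) * x i := by
      rw [Finset.sum_mul, ← Finset.sum_add_distrib, Finset.sum_mul]
      exact Finset.sum_congr rfl fun j _ => by ring
    rw [h1, h2]
    ring
  simp_rw [hrow]
  rw [Finset.sum_add_distrib]
  have hswap : ∑ i, ∑ j, w i j * (x i - x j) * x i
      = ∑ i, ∑ j, -(w i j * (x i - x j) * x j) := by
    rw [Finset.sum_comm]
    refine Finset.sum_congr rfl fun i _ => Finset.sum_congr rfl fun j _ => ?_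
    rw [hsym j i]
    ring
  have hsq : 0 ≤ ∑ i, ∑ j, w i j * (x i - x j) ^ 2 :=
    Finset.sum_nonneg fun i _ => Finset.sum_nonneg fun j _ =>
      mul_nonneg (hw i j) (sq_nonneg _)
  have hadd : ∑ i, ∑ j, w i j * (x i - x j) ^ 2
      = ∑ i, ∑ j, w i j * (x i - x j) * x i + ∑ i, ∑ j, -(w i j * (x i - x j) * x j) := by
    simp_rw [← Finset.sum_add_distrib]
    exact Finset.sum_congr rfl fun i _ => Finset.sum_congr rfl fun j _ => by ring
  have hpos : 0 < ∑ i, d i * x i ^ 2 := by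
    obtain ⟨k, hk⟩ := Function.ne_iff.mp hx
    have hk' : x k ≠ 0 := hk
    refine Finset.sum_pos' (fun i _ => mul_nonneg (hd i).le (sq_nonneg _))
      ⟨k, Finset.mem_univ k, mul_pos (hd k) (by positivity)⟩
  linarith

/-- The dense stiffness matrix of the 1D Dirichlet fractional Laplacian is symmetric
and positive definite: `Aᵀ = A` and `⟨A x, x⟩ > 0` for every nonzero `x`. -/
theorem stiffness_matrix_symmetric_posdef
    (N : ℕ) (hN : 2 ≤ N) (s h c : ℝ)
    (hs : s ∈ Set.Ioo (0 : ℝ) 1) (hh : 0 < h) (hc : 0 < c)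
    (A : Matrix (Fin (N - 1)) (Fin (N - 1)) ℝ)
    (hoff : ∀ i j : Fin (N - 1), i ≠ j →
      A i j = -(c / h ^ (2 * s)) * |((i : ℕ) + 1 : ℝ) - ((j : ℕ) + 1 : ℝ)| ^ (-(1 + 2 * s)))
    (hdiag : ∀ i : Fin (N - 1),
      A i i = (c / h ^ (2 * s)) *
        ((∑ j ∈ Finset.univ.erase i,
            |((i : ℕ) + 1 : ℝ) - ((j : ℕ) + 1 : ℝ)| ^ (-(1 + 2 * s)))
          + (1 / (2 * s)) * (((i : ℕ) + 1 : ℝ) ^ (-(2 * s))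
              + ((N : ℝ) - ((i : ℕ) + 1)) ^ (-(2 * s))))) :
    Aᵀ = A ∧ ∀ x : Fin (N - 1) → ℝ, x ≠ 0 → 0 < A.mulVec x ⬝ᵥ x := by
  have hs0 : 0 < s := hs.1
  have hK : 0 < c / h ^ (2 * s) := div_pos hc (Real.rpow_pos_of_pos hh _)
  constructor
  · ext i j
    rw [Matrix.transpose_apply]
    by_cases hij : i = j
    · rw [hij]
    · rw [hoff i j hij, hoff j i (Ne.symm hij), abs_sub_comm]
  · intro x hx
    refine laplacian_add_diag_pos A
      (fun i j => (c / h ^ (2 * s)) *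
        |((i : ℕ) + 1 : ℝ) - ((j : ℕ) + 1 : ℝ)| ^ (-(1 + 2 * s)))
      (fun i => (c / h ^ (2 * s)) * ((1 / (2 * s)) * (((i : ℕ) + 1 : ℝ) ^ (-(2 * s))
              + ((N : ℝ) - ((i : ℕ) + 1)) ^ (-(2 * s))))) ?_ ?_ ?_ ?_ ?_ x hx
    · intro i j
      exact mul_nonneg hK.le (Real.rpow_nonneg (abs_nonneg _) _)
    · intro i j
      rw [abs_sub_comm]
    · intro i
      have hi : ((i : ℕ) + 1 : ℝ) < N := by
        have := i.isLt
        have h2 : (i : ℕ) + 1 < N := by omega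
        exact_mod_cast h2
      have h1 : (0 : ℝ) < ((i : ℕ) + 1 : ℝ) := by positivity
      have h3 := Real.rpow_pos_of_pos h1 (-(2 * s))
      have h4 := Real.rpow_pos_of_pos (sub_pos.mpr hi) (-(2 * s))
      exact mul_pos hK (mul_pos (by positivity) (add_pos h3 h4))
    · intro i j hij
      rw [hoff i j hij]
      ring
    · intro i
      rw [hdiag i, mul_add, Finset.mul_sum]
end

section
/- Let s ∈ (0,1), let u : ℝ → ℝ be twice continuously differentiable, let x ∈ ℝ, h > 0, and let M := sup_{|y − x| ≤ h} |u''(y)|. Then the principal value lim_{ε → 0⁺} ∫_{{y : ε ≤ |x − y| ≤ h}} (u(x) − u(y)) / |x − y|^{1+2s} dy exists, and its absolute value is at most M · h^{2 − 2s} / (2(1 − s)). -/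
open MeasureTheory

lemma nf_second_diff (u : ℝ → ℝ) (hu : ContDiff ℝ 2 u) (x h M : ℝ)
    (hM : ∀ y ∈ Set.Icc (x - h) (x + h), |deriv (deriv u) y| ≤ M)
    (t : ℝ) (ht : t ∈ Set.Icc 0 h) :
    |2 * u x - u (x + t) - u (x - t)| ≤ M * t ^ 2 := by
  have hd : Differentiable ℝ u := hu.differentiable (by norm_num)
  have hu1 : ContDiff ℝ 1 (deriv u) := by
    have : ContDiff ℝ (1 + 1) u := by
      convert hu using 1
      norm_num
    exact (contDiff_succ_iff_deriv.1 this).2.2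
  have hd1 : Differentiable ℝ (deriv u) := hu1.differentiable (by norm_num)
  have hφ : ∀ r : ℝ, HasDerivAt (fun r => 2 * u x - u (x + r) - u (x - r))
      (-deriv u (x + r) + deriv u (x - r)) r := by
    intro r
    have h1 : HasDerivAt (fun r => u (x + r)) (deriv u (x + r)) r := by
      have := (hd (x + r)).hasDerivAt.comp r ((hasDerivAt_id r).const_add x)
      simpa [Function.comp_def] using this
    have h2 : HasDerivAt (fun r => u (x - r)) (-deriv u (x - r)) r := by
      have := (hd (x - r)).hasDerivAt.comp r ((hasDerivAt_id r).const_sub x)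
      simpa [Function.comp_def] using this
    exact ((h1.const_sub (2 * u x)).sub h2).congr_deriv (by ring)
  have key := image_norm_le_of_norm_deriv_right_le_deriv_boundary
    (f := fun r => 2 * u x - u (x + r) - u (x - r))
    (f' := fun r => -deriv u (x + r) + deriv u (x - r)) (a := 0) (b := h)
    (B := fun r => M * r ^ 2) (B' := fun r => 2 * M * r)
    (fun r _ => (hφ r).continuousAt.continuousWithinAt)
    (fun r _ => (hφ r).hasDerivWithinAt)
    (by simp; ring_nf)
    (fun r => by
      exact ((hasDerivAt_pow 2 r).const_mul M).congr_deriv (by push_cast; ring))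
    (by
      intro r hr
      have := Convex.norm_image_sub_le_of_norm_deriv_le (f := deriv u)
        (s := Set.Icc (x - h) (x + h)) (C := M) (x := x + r) (y := x - r)
        (fun y _ => hd1 y) (fun y hy => hM y hy) (convex_Icc _ _)
        ⟨by linarith [hr.1, hr.2], by linarith [hr.1, hr.2]⟩
        ⟨by linarith [hr.1, hr.2], by linarith [hr.1, hr.2]⟩
      have h3 : ‖x - r - (x + r)‖ = 2 * r := by
        rw [Real.norm_eq_abs, show x - r - (x + r) = -(2 * r) by ring, abs_neg,
          abs_of_nonneg (by linarith [hr.1])]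
      rw [h3] at this
      calc _ = ‖deriv u (x - r) - deriv u (x + r)‖ := by congr 1; ring
        _ ≤ _ := by linarith)
  exact key ht

lemma nf_integral_eq (s : ℝ) (u : ℝ → ℝ) (hu : Continuous u) (x h ε : ℝ)
    (hε : 0 < ε) (hεh : ε ≤ h) :
    ∫ y in {y : ℝ | ε ≤ |x - y| ∧ |x - y| ≤ h}, (u x - u y) / |x - y| ^ (1 + 2 * s)
      = ∫ t in ε..h, (2 * u x - u (x + t) - u (x - t)) / t ^ (1 + 2 * s) := by
  set f : ℝ → ℝ := fun y => (u x - u y) / |x - y| ^ (1 + 2 * s) with hf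
  have hset : {y : ℝ | ε ≤ |x - y| ∧ |x - y| ≤ h}
      = Set.Icc (x - h) (x - ε) ∪ Set.Icc (x + ε) (x + h) := by
    ext y
    simp only [Set.mem_ofPred_eq, Set.mem_union, Set.mem_Icc]
    rcases abs_cases (x - y) with ⟨h1, h2⟩ | ⟨h1, h2⟩ <;> rw [h1] <;> constructor
    · rintro ⟨a, b⟩; left; constructor <;> linarith
    · rintro (⟨a, b⟩ | ⟨a, b⟩) <;> constructor <;> linarith
    · rintro ⟨a, b⟩; right; constructor <;> linarith
    · rintro (⟨a, b⟩ | ⟨a, b⟩) <;> constructor <;> linarith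
  have hfc : ∀ S : Set ℝ, (∀ y ∈ S, y ≠ x) → ContinuousOn f S := by
    intro S hS
    have hne : ∀ y ∈ S, |x - y| ≠ 0 := fun y hy =>
      abs_ne_zero.2 (sub_ne_zero.2 (hS y hy).symm)
    refine ContinuousOn.div (by fun_prop) ?_ ?_
    · exact ContinuousOn.rpow_const (by fun_prop) (fun y hy => Or.inl (hne y hy))
    · intro y hy
      exact (Real.rpow_pos_of_pos (lt_of_le_of_ne (abs_nonneg _) (hne y hy).symm) _).ne'
  have hc1 : ContinuousOn f (Set.Icc (x - h) (x - ε)) :=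
    hfc _ (fun y hy he => by linarith [hy.2])
  have hc2 : ContinuousOn f (Set.Icc (x + ε) (x + h)) :=
    hfc _ (fun y hy he => by linarith [hy.1])
  have i1 := hc1.integrableOn_Icc (μ := volume)
  have i2 := hc2.integrableOn_Icc (μ := volume)
  rw [hset, setIntegral_union _ measurableSet_Icc i1 i2]
  · rw [integral_Icc_eq_integral_Ioc, integral_Icc_eq_integral_Ioc,
      ← intervalIntegral.integral_of_le (by linarith),
      ← intervalIntegral.integral_of_le (by linarith),
      ← intervalIntegral.integral_comp_sub_left, ← intervalIntegral.integral_comp_add_left,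
      ← intervalIntegral.integral_add]
    · apply intervalIntegral.integral_congr
      intro t ht
      rw [Set.uIcc_of_le hεh] at ht
      have ht0 : 0 < t := lt_of_lt_of_le hε ht.1
      simp only [hf]
      rw [show x - (x - t) = t by ring, show x - (x + t) = -t by ring, abs_neg, abs_of_pos ht0]
      ring
    · apply ContinuousOn.intervalIntegrable
      rw [Set.uIcc_of_le hεh]
      exact hc1.comp (by fun_prop) (fun t ht => ⟨by linarith [ht.2], by linarith [ht.1]⟩)
    · apply ContinuousOn.intervalIntegrable
      rw [Set.uIcc_of_le hεh]
      exact hc2.comp (by fun_prop) (fun t ht => ⟨by linarith [ht.1], by linarith [ht.2]⟩)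
  · rw [Set.disjoint_left]
    intro y h1 h2
    linarith [h1.2, h2.1]


/-- Near-field estimate for the fractional Laplacian: for `u ∈ C²`, the principal
value `lim_{ε→0⁺} ∫_{ε ≤ |x−y| ≤ h} (u(x) − u(y))/|x − y|^{1+2s} dy` exists and is
bounded in absolute value by `M h^{2−2s} / (2(1−s))`, where
`M = sup_{|y−x| ≤ h} |u''(y)|`. -/
theorem near_field_principal_value_estimate
    (s : ℝ) (hs : s ∈ Set.Ioo (0 : ℝ) 1)
    (u : ℝ → ℝ) (hu : ContDiff ℝ 2 u)
    (x h : ℝ) (hh : 0 < h)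
    (M : ℝ) (hM : M = sSup ((fun y => |deriv (deriv u) y|) '' Set.Icc (x - h) (x + h))) :
    ∃ I : ℝ,
      Filter.Tendsto
        (fun ε : ℝ =>
          ∫ y in {y : ℝ | ε ≤ |x - y| ∧ |x - y| ≤ h},
            (u x - u y) / |x - y| ^ (1 + 2 * s))
        (nhdsWithin 0 (Set.Ioi 0)) (nhds I)
      ∧ |I| ≤ M * h ^ (2 - 2 * s) / (2 * (1 - s)) := by
  obtain ⟨hs0, hs1⟩ := hs
  have hu1 : ContDiff ℝ 1 (deriv u) := by
    have : ContDiff ℝ (1 + 1) u := by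
      convert hu using 1
      norm_num
    exact (contDiff_succ_iff_deriv.1 this).2.2
  have hc : Continuous (deriv (deriv u)) := hu1.continuous_deriv (by norm_num)
  have hMb : ∀ y ∈ Set.Icc (x - h) (x + h), |deriv (deriv u) y| ≤ M := by
    intro y hy
    rw [hM]
    exact le_csSup (isCompact_Icc.image hc.abs).bddAbove ⟨y, hy, rfl⟩
  have hcu : Continuous u := hu.continuous
  set g : ℝ → ℝ := fun t => (2 * u x - u (x + t) - u (x - t)) / t ^ (1 + 2 * s) with hg
  have hgm : Measurable g := by
    have : Measurable (fun t => 2 * u x - u (x + t) - u (x - t)) :=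
      Continuous.measurable (by fun_prop)
    exact this.div (measurable_id.pow_const _)
  have hgb : ∀ t ∈ Set.Ioc 0 h, ‖g t‖ ≤ M * t ^ (1 - 2 * s) := by
    intro t ht
    have ht0 : 0 < t := ht.1
    have hp := Real.rpow_pos_of_pos ht0 (1 + 2 * s)
    rw [hg, Real.norm_eq_abs, abs_div, abs_of_pos hp, div_le_iff₀ hp, mul_assoc,
      ← Real.rpow_add ht0, show 1 - 2 * s + (1 + 2 * s) = (2 : ℕ) by push_cast; ring,
      Real.rpow_natCast]
    exact nf_second_diff u hu x h M hMb t ⟨ht0.le, ht.2⟩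
  have hbi : IntervalIntegrable (fun t : ℝ => M * t ^ (1 - 2 * s)) volume 0 h :=
    (intervalIntegral.intervalIntegrable_rpow' (by linarith)).const_mul M
  have hgi : IntegrableOn g (Set.uIcc 0 h) := by
    rw [Set.uIcc_of_le hh.le, integrableOn_Icc_iff_integrableOn_Ioc]
    have hb := (intervalIntegrable_iff_integrableOn_Ioc_of_le hh.le).1 hbi
    refine Integrable.mono' hb hgm.aestronglyMeasurable ?_
    exact (ae_restrict_iff' measurableSet_Ioc).2 (Filter.Eventually.of_forall hgb)
  refine ⟨∫ t in (0 : ℝ)..h, g t, ?_, ?_⟩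
  · have hcont := intervalIntegral.continuousOn_primitive_interval_left hgi 0 Set.left_mem_uIcc
    rw [Set.uIcc_of_le hh.le] at hcont
    have hmem : Set.Ioc 0 h ∈ nhdsWithin (0 : ℝ) (Set.Ioi 0) := Ioc_mem_nhdsGT hh
    have ht := hcont.tendsto.mono_left
      (nhdsWithin_le_of_mem (Filter.mem_of_superset hmem Set.Ioc_subset_Icc_self))
    refine ht.congr' ?_
    filter_upwards [hmem] with ε hε
    exact (nf_integral_eq s u hcu x h ε hε.1 hε.2).symm
  · have := intervalIntegral.norm_integral_le_of_norm_le hh.le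
      (Filter.Eventually.of_forall hgb) hbi
    rw [intervalIntegral.integral_const_mul, integral_rpow (Or.inl (by linarith))] at this
    rw [Real.norm_eq_abs, Real.zero_rpow (by linarith)] at this
    refine this.trans (le_of_eq ?_)
    rw [show 1 - 2 * s + 1 = 2 - 2 * s by ring, show 2 * (1 - s) = 2 - 2 * s by ring]
    ring
end

section
/- Let n ≥ 1, let A be a real symmetric positive semidefinite n × n matrix, let τ > 0, M ≥ 1 and δ ≥ 0. Let e⁰, …, e^M ∈ ℝⁿ and ξ⁰, …, ξ^{M−1} ∈ ℝⁿ satisfy e⁰ = 0 and, for each k = 0, …, M−1, (eᵏ⁺¹ − eᵏ)/τ + (1/2) A (eᵏ⁺¹ + eᵏ) = ξᵏ, with ‖ξᵏ‖ ≤ δ for all k. Then for every m with 0 ≤ m ≤ M, ‖eᵐ‖ ≤ m τ δ; in particular max_{0 ≤ m ≤ M} ‖eᵐ‖ ≤ M τ δ. -/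
/-- Error-propagation estimate for the Crank–Nicolson scheme: if the errors `eᵏ`
satisfy the CN scheme with defects `ξᵏ` bounded by `δ` and zero initial error,
then `‖eᵐ‖ ≤ m τ δ` for all `0 ≤ m ≤ M`, and in particular
`max_{0 ≤ m ≤ M} ‖eᵐ‖ ≤ M τ δ`. -/
theorem CN_error_propagation
    (n : ℕ) (hn : 1 ≤ n) (A : Matrix (Fin n) (Fin n) ℝ)
    (hA : A.IsSymm) (hApsd : A.PosSemidef)
    (τ : ℝ) (hτ : 0 < τ) (M : ℕ) (hM : 1 ≤ M) (δ : ℝ) (hδ : 0 ≤ δ)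
    (e ξ : ℕ → EuclideanSpace ℝ (Fin n))
    (he0 : e 0 = 0)
    (hstep : ∀ k < M,
      τ⁻¹ • (e (k + 1) - e k)
          + (1 / 2 : ℝ) • Matrix.toEuclideanLin A (e (k + 1) + e k)
        = ξ k)
    (hξ : ∀ k < M, ‖ξ k‖ ≤ δ) :
    (∀ m ≤ M, ‖e m‖ ≤ m * τ * δ) ∧ (∀ m ≤ M, ‖e m‖ ≤ M * τ * δ) := by
  have hpos : ∀ x : EuclideanSpace ℝ (Fin n), 0 ≤ inner ℝ (Matrix.toEuclideanLin A x) x :=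
    (Matrix.isPositive_toEuclideanLin_iff.2 hApsd).2
  have step : ∀ k < M, ‖e (k + 1)‖ ≤ ‖e k‖ + τ * δ := by
    intro k hk
    have h1 : inner ℝ (e (k + 1) - e k) (e (k + 1) + e k) = ‖e (k + 1)‖ ^ 2 - ‖e k‖ ^ 2 := by
      rw [inner_sub_left, inner_add_right, inner_add_right, real_inner_self_eq_norm_sq,
        real_inner_self_eq_norm_sq, real_inner_comm (e k) (e (k + 1))]
      ring
    have h2 := congrArg (fun v => inner ℝ v (e (k + 1) + e k)) (hstep k hk)
    simp only [inner_add_left (𝕜 := ℝ) (τ⁻¹ • (e (k + 1) - e k)), real_inner_smul_left, h1] at h2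
    have h3 := hpos (e (k + 1) + e k)
    have h4 : inner ℝ (ξ k) (e (k + 1) + e k) ≤ δ * (‖e (k + 1)‖ + ‖e k‖) :=
      (real_inner_le_norm _ _).trans
        (mul_le_mul (hξ k hk) (norm_add_le _ _) (norm_nonneg _) hδ)
    have h5 : τ⁻¹ * (‖e (k + 1)‖ ^ 2 - ‖e k‖ ^ 2) ≤ δ * (‖e (k + 1)‖ + ‖e k‖) := by linarith
    rw [inv_mul_le_iff₀ hτ] at h5
    have ha := norm_nonneg (e (k + 1))
    have hb := norm_nonneg (e k)
    have hc : 0 ≤ τ * δ := by positivity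
    by_contra! hlt
    have hp : 0 < ‖e (k + 1)‖ + ‖e k‖ := by linarith
    have := mul_pos hp (sub_pos.2 hlt)
    nlinarith
  have main : ∀ m ≤ M, ‖e m‖ ≤ m * τ * δ := by
    intro m
    induction m with
    | zero => intro _; simp [he0]
    | succ k ih =>
      intro hk
      have h1 := ih (by omega)
      have h2 := step k (by omega)
      push_cast
      linarith
  refine ⟨main, fun m hm => (main m hm).trans ?_⟩
  have : (m : ℝ) ≤ M := by exact_mod_cast hm
  gcongr
end
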